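/- Let K ⊂ ℝ^N be a convex body and fix r > 0. Then the function γ(x) = |K ∩ B(x,r)| (Lebesgue measure of the intersection of K with the closed ball of radius r centered at x) is log-concave on ℝ^N, and the set of its maximum points M(γ) = {x ∈ ℝ^N : γ(x) = max γ} has nonempty intersection with the heart ♥(K). -/

import Mathlib

open MeasureTheory Set Metric
open scoped RealInnerProductSpace ENNReal NNReal

noncomputable section

/-- Reflection of `x` across the hyperplane `{z : ⟪z, ω⟫ = l}` (for a unit vector `ω`). -/
def reflectH {N : ℕ} (l : ℝ) (ω x : EuclideanSpace ℝ (Fin N)) : EuclideanSpace ℝ (Fin N) :=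
  x + (2 * (l - ⟪x, ω⟫)) • ω

/-- The maximal folding function of a set `K`:
`R_K(ω) = inf {l : the reflection of K ∩ {⟪·,ω⟫ ≥ l} across {⟪·,ω⟫ = l} lies in K}`. -/
def foldingFn {N : ℕ} (K : Set (EuclideanSpace ℝ (Fin N))) (ω : EuclideanSpace ℝ (Fin N)) : ℝ :=
  sInf {l : ℝ | reflectH l ω '' {x ∈ K | l ≤ ⟪x, ω⟫} ⊆ K}

/-- The heart of a set `K`. -/
def heart {N : ℕ} (K : Set (EuclideanSpace ℝ (Fin N))) : Set (EuclideanSpace ℝ (Fin N)) :=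
  {x ∈ K | ∀ ω : EuclideanSpace ℝ (Fin N), ‖ω‖ = 1 → ⟪x, ω⟫ ≤ foldingFn K ω}


theorem Real.volume_add_le_of_isCompact {A B : Set ℝ} (hA : IsCompact A) (hB : IsCompact B)
    (hA' : A.Nonempty) (hB' : B.Nonempty) {S : Set ℝ}
    (hS : ∀ x ∈ A, ∀ y ∈ B, x + y ∈ S) : volume A + volume B ≤ volume S := by
  obtain ⟨p, hp, hpA⟩ := hA.exists_isGreatest hA'
  obtain ⟨q, hq, hqB⟩ := hB.exists_isLeast hB'
  have h1 : volume ((fun x => x + q) '' A) = volume A := by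
    simp
  have h2 : volume ((fun x => p + x) '' B) = volume B := by
    simp
  rw [← h1, ← h2, ← measure_union₀]
  · apply measure_mono
    rintro _ (⟨x, hx, rfl⟩ | ⟨x, hx, rfl⟩)
    · exact hS _ hx _ hq
    · exact hS _ hp _ hx
  · exact (hB.image (by fun_prop)).measurableSet.nullMeasurableSet
  · refine measure_mono_null (t := {p + q}) ?_ (by simp)
    rintro _ ⟨⟨x, hx, rfl⟩, ⟨y, hy, hxy⟩⟩
    have := hpA hx
    have := hqB hy
    simp only [mem_singleton_iff] at *
    linarith

theorem Real.volume_add_le {A B : Set ℝ} (hA : MeasurableSet A) (hB : MeasurableSet B)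
    (hA' : A.Nonempty) (hB' : B.Nonempty) {S : Set ℝ}
    (hS : ∀ x ∈ A, ∀ y ∈ B, x + y ∈ S) : volume A + volume B ≤ volume S := by
  obtain ⟨p, hp⟩ := hA'
  obtain ⟨q, hq⟩ := hB'
  rcases eq_or_ne (volume A) 0 with hA0 | hA0
  · rw [hA0, zero_add, ← measure_preimage_add volume (-p) B]
    refine measure_mono fun x hx => ?_
    simpa using hS p hp _ hx
  rcases eq_or_ne (volume B) 0 with hB0 | hB0
  · rw [hB0, add_zero, ← measure_preimage_add volume (-q) A]
    refine measure_mono fun x hx => ?_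
    simpa using hS _ hx q hq
  refine le_of_forall_lt fun c hc => ?_
  obtain ⟨u, hu, v, hv, huv⟩ := ENNReal.exists_lt_add_of_lt_add hc hA0 hB0
  obtain ⟨C, hCA, hC, huC⟩ := hA.exists_lt_isCompact hu
  obtain ⟨D, hDB, hD, hvD⟩ := hB.exists_lt_isCompact hv
  refine huv.trans_le ((add_le_add huC.le hvD.le).trans ?_)
  exact Real.volume_add_le_of_isCompact hC hD (nonempty_of_measure_ne_zero huC.ne_bot)
    (nonempty_of_measure_ne_zero hvD.ne_bot) fun x hx y hy => hS x (hCA hx) y (hDB hy)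

theorem ENNReal.rpow_mul_rpow_le_add {a b : ℝ} (ha : 0 < a) (hb : 0 < b) (hab : a + b = 1)
    (x y : ℝ≥0∞) : x ^ a * y ^ b ≤ ENNReal.ofReal a * x + ENNReal.ofReal b * y := by
  have hp : (1 / a).HolderConjugate (1 / b) := by
    constructor <;> simp [*]
  have := ENNReal.young_inequality (x ^ a) (y ^ b) hp
  rw [← ENNReal.rpow_mul, ← ENNReal.rpow_mul, mul_one_div_cancel ha.ne',
    mul_one_div_cancel hb.ne', ENNReal.rpow_one, ENNReal.rpow_one, one_div, one_div,
    ENNReal.ofReal_inv_of_pos ha, ENNReal.ofReal_inv_of_pos hb] at this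
  simpa [div_eq_mul_inv, mul_comm] using this

theorem lintegral_eq_lintegral_Ioo_meas_lt {f : ℝ → ℝ≥0∞} (hf : Measurable f) (hf1 : ∀ x, f x ≤ 1) :
    ∫⁻ x, f x = ∫⁻ s in Ioo (0 : ℝ) 1, volume {x | ENNReal.ofReal s < f x} := by
  have hfin : ∀ x, f x ≠ ∞ := fun x => ((hf1 x).trans_lt ENNReal.one_lt_top).ne
  have := lintegral_eq_lintegral_meas_lt (volume : Measure ℝ) (f := fun x => (f x).toReal)
    (Filter.Eventually.of_forall fun x => ENNReal.toReal_nonneg) hf.ennreal_toReal.aemeasurable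
  simp only [ENNReal.ofReal_toReal (hfin _)] at this
  rw [this, ← Ioo_union_Ici_eq_Ioi (zero_lt_one (α := ℝ)), lintegral_union measurableSet_Ici
    (by rw [disjoint_left]; intro x hx hx'; exact absurd hx.2 (not_lt.2 hx')),
    setLIntegral_congr_fun (g := fun _ => 0) measurableSet_Ici, lintegral_zero, add_zero]
  · refine setLIntegral_congr_fun measurableSet_Ioo fun s hs => ?_
    simp only [ENNReal.ofReal_lt_iff_lt_toReal hs.1.le (hfin _)]
  · intro s hs
    have : {x | s < (f x).toReal} = ∅ := by
      ext x
      simp only [mem_ofPred_eq, mem_empty_iff_false, iff_false, not_lt]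
      exact (ENNReal.toReal_mono ENNReal.one_ne_top (hf1 x)).trans (by simpa using hs)
    simp [this]

theorem lintegral_add_le_of_iSup_eq_one {a b : ℝ} (ha : 0 < a) (hb : 0 < b)
    {f g h : ℝ → ℝ≥0∞} (hf : Measurable f) (hg : Measurable g) (hh : Measurable h)
    (hf1 : ⨆ x, f x = 1) (hg1 : ⨆ x, g x = 1)
    (H : ∀ x y, min (f x) (g y) ≤ h (a * x + b * y)) :
    ENNReal.ofReal a * (∫⁻ x, f x) + ENNReal.ofReal b * (∫⁻ x, g x) ≤ ∫⁻ x, h x := by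
  have hf2 : ∀ x, f x ≤ 1 := fun x => hf1 ▸ le_iSup f x
  have hg2 : ∀ x, g x ≤ 1 := fun x => hg1 ▸ le_iSup g x
  have hle : ∫⁻ x, min (h x) 1 ≤ ∫⁻ x, h x := lintegral_mono fun x => min_le_left _ _
  refine le_trans ?_ hle
  have meas : ∀ {f : ℝ → ℝ≥0∞}, Measurable fun s : ℝ => volume {x | ENNReal.ofReal s < f x} := by
    intro f
    refine Antitone.measurable fun s t hst => measure_mono fun x hx => ?_
    exact (ENNReal.ofReal_le_ofReal hst).trans_lt hx
  rw [lintegral_eq_lintegral_Ioo_meas_lt hf hf2, lintegral_eq_lintegral_Ioo_meas_lt hg hg2,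
    lintegral_eq_lintegral_Ioo_meas_lt (hh.min measurable_const) fun x => min_le_right _ _,
    ← lintegral_const_mul _ meas, ← lintegral_const_mul _ meas, ← lintegral_add_left
    (meas.const_mul _)]
  refine setLIntegral_mono' measurableSet_Ioo fun s hs => ?_
  have hs1 : ENNReal.ofReal s < 1 := by simpa using hs.2
  have key : ∀ {c : ℝ} (hc : 0 < c) (A : Set ℝ),
      ENNReal.ofReal c * volume A = volume ((fun x => c * x) '' A) := by
    intro c hc A
    have := Measure.addHaar_smul (volume : Measure ℝ) c A
    rw [Module.finrank_self, pow_one, abs_of_pos hc] at this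
    exact this.symm
  have ms : ∀ {c : ℝ} (hc : 0 < c) {A : Set ℝ}, MeasurableSet A →
      MeasurableSet ((fun x => c * x) '' A) := fun {c} _ _ hA =>
    hA.const_smul₀ c
  rw [key ha, key hb]
  refine Real.volume_add_le (ms ha (measurableSet_lt measurable_const hf))
    (ms hb (measurableSet_lt measurable_const hg)) ?_ ?_ ?_
  · obtain ⟨x, hx⟩ := lt_iSup_iff.1 (hs1.trans_eq hf1.symm)
    exact ⟨_, mem_image_of_mem _ hx⟩
  · obtain ⟨x, hx⟩ := lt_iSup_iff.1 (hs1.trans_eq hg1.symm)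
    exact ⟨_, mem_image_of_mem _ hx⟩
  · rintro _ ⟨x, hx, rfl⟩ _ ⟨y, hy, rfl⟩
    exact lt_min ((lt_min hx hy).trans_le (H x y)) hs1


theorem ENNReal.min_le_rpow_mul_rpow {a b : ℝ} (ha : 0 < a) (hb : 0 < b) (hab : a + b = 1)
    (x y : ℝ≥0∞) : min x y ≤ x ^ a * y ^ b := by
  calc min x y = min x y ^ a * min x y ^ b := by
        rw [← ENNReal.rpow_add_of_nonneg _ _ ha.le hb.le, hab, ENNReal.rpow_one]
    _ ≤ x ^ a * y ^ b := by gcongr <;> simp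

theorem prekopaLeindler_real_of_bounded {a b : ℝ} (ha : 0 < a) (hb : 0 < b) (hab : a + b = 1)
    {f g h : ℝ → ℝ≥0∞} (hf : Measurable f) (hg : Measurable g) (hh : Measurable h)
    (hf1 : (⨆ x, f x) ≠ ∞) (hg1 : (⨆ x, g x) ≠ ∞)
    (H : ∀ x y, f x ^ a * g y ^ b ≤ h (a * x + b * y)) :
    (∫⁻ x, f x) ^ a * (∫⁻ x, g x) ^ b ≤ ∫⁻ x, h x := by
  rcases eq_or_ne (⨆ x, f x) 0 with hf0 | hf0
  · have : ∀ x, f x = 0 := by simpa using hf0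
    simp [this, ha]
  rcases eq_or_ne (⨆ x, g x) 0 with hg0 | hg0
  · have : ∀ x, g x = 0 := by simpa using hg0
    simp [this, hb]
  set α := ⨆ x, f x
  set β := ⨆ x, g x
  have hc : ∀ x y : ℝ≥0∞, (α⁻¹ * x) ^ a * (β⁻¹ * y) ^ b = α⁻¹ ^ a * β⁻¹ ^ b * (x ^ a * y ^ b) := by
    intro x y
    rw [ENNReal.mul_rpow_of_nonneg _ _ ha.le, ENNReal.mul_rpow_of_nonneg _ _ hb.le]
    ring
  have hc0 : α⁻¹ ^ a * β⁻¹ ^ b ≠ 0 := by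
    simp [hf1, hg1, hf0, hg0]
  have hct : α⁻¹ ^ a * β⁻¹ ^ b ≠ ∞ :=
    ENNReal.mul_ne_top (by simp [hf1, hf0]) (by simp [hg1, hg0])
  rw [← ENNReal.mul_le_mul_iff_right hc0 hct, ← hc, ← lintegral_const_mul _ hf,
    ← lintegral_const_mul _ hg, ← lintegral_const_mul _ hh]
  refine (ENNReal.rpow_mul_rpow_le_add ha hb hab _ _).trans ?_
  refine lintegral_add_le_of_iSup_eq_one ha hb (hf.const_mul _) (hg.const_mul _) (hh.const_mul _)
    ?_ ?_ fun x y => ?_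
  · rw [← ENNReal.mul_iSup, ENNReal.inv_mul_cancel hf0 hf1]
  · rw [← ENNReal.mul_iSup, ENNReal.inv_mul_cancel hg0 hg1]
  · refine (ENNReal.min_le_rpow_mul_rpow ha hb hab _ _).trans ?_
    rw [hc]
    gcongr
    exact H x y

theorem tendsto_lintegral_min_natCast {f : ℝ → ℝ≥0∞} (hf : Measurable f) :
    Filter.Tendsto (fun n : ℕ => ∫⁻ x, min (f x) n) Filter.atTop (nhds (∫⁻ x, f x)) := by
  refine lintegral_tendsto_of_tendsto_of_monotone (fun n => (hf.min measurable_const).aemeasurable)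
    (Filter.Eventually.of_forall fun x n m hnm => ?_) (Filter.Eventually.of_forall fun x => ?_)
  · exact min_le_min le_rfl (by exact_mod_cast hnm)
  · simpa using (tendsto_const_nhds (x := f x)).min ENNReal.tendsto_nat_nhds_top

/-- The Prékopa–Leindler inequality on the real line. -/
theorem prekopaLeindler_real {a b : ℝ} (ha : 0 < a) (hb : 0 < b) (hab : a + b = 1)
    {f g h : ℝ → ℝ≥0∞} (hf : Measurable f) (hg : Measurable g) (hh : Measurable h)
    (H : ∀ x y, f x ^ a * g y ^ b ≤ h (a * x + b * y)) :
    (∫⁻ x, f x) ^ a * (∫⁻ x, g x) ^ b ≤ ∫⁻ x, h x := by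
  rcases eq_or_ne (∫⁻ x, f x) 0 with hf0 | hf0
  · simp [hf0, ha]
  rcases eq_or_ne (∫⁻ x, g x) 0 with hg0 | hg0
  · simp [hg0, hb]
  have bdd : ∀ (u : ℝ → ℝ≥0∞) (n : ℕ), (⨆ x, min (u x) n) ≠ ∞ := fun u n =>
    ((iSup_le fun x => min_le_right _ _).trans_lt (ENNReal.natCast_lt_top n)).ne
  refine le_of_tendsto (ENNReal.Tendsto.mul ((tendsto_lintegral_min_natCast hf).ennrpow_const a)
    (Or.inl (by simp [hf0, ha, ha.le])) ((tendsto_lintegral_min_natCast hg).ennrpow_const b)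
    (Or.inl (by simp [hg0, hb, hb.le]))) (Filter.Eventually.of_forall fun n => ?_)
  refine prekopaLeindler_real_of_bounded ha hb hab (hf.min measurable_const)
    (hg.min measurable_const) hh (bdd f n) (bdd g n) fun x y => le_trans ?_ (H x y)
  gcongr <;> exact min_le_left _ _

theorem lintegral_fin_succ {n : ℕ} {f : (Fin (n + 1) → ℝ) → ℝ≥0∞} (hf : Measurable f) :
    ∫⁻ x, f x = ∫⁻ s : ℝ, ∫⁻ v : Fin n → ℝ, f (Fin.cons s v) := by
  have e := (volume_preserving_piFinSuccAbove (fun _ : Fin (n + 1) => ℝ) 0).symm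
  rw [← e.lintegral_comp hf, Measure.volume_eq_prod, lintegral_prod
    (fun p => f ((MeasurableEquiv.piFinSuccAbove (fun _ => ℝ) 0).symm p))
    (hf.comp e.measurable).aemeasurable]
  simp [MeasurableEquiv.piFinSuccAbove, Fin.consEquiv]

/-- The Prékopa–Leindler inequality on `ℝⁿ`. -/
theorem prekopaLeindler {a b : ℝ} (ha : 0 < a) (hb : 0 < b) (hab : a + b = 1) {n : ℕ}
    {f g h : (Fin n → ℝ) → ℝ≥0∞} (hf : Measurable f) (hg : Measurable g) (hh : Measurable h)
    (H : ∀ x y, f x ^ a * g y ^ b ≤ h (a • x + b • y)) :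
    (∫⁻ x, f x) ^ a * (∫⁻ x, g x) ^ b ≤ ∫⁻ x, h x := by
  induction n with
  | zero =>
    simp only [lintegral_unique, volume_pi, Measure.pi_univ, Finset.univ_eq_empty,
      Finset.prod_empty, mul_one]
    convert H default default
  | succ n ih =>
    have mcons : Measurable fun p : ℝ × (Fin n → ℝ) => (Fin.cons p.1 p.2 : Fin (n + 1) → ℝ) := by
      refine measurable_pi_lambda _ fun i => ?_
      refine Fin.cases ?_ (fun i => ?_) i <;> simp <;> fun_prop
    have mint : ∀ {f : (Fin (n + 1) → ℝ) → ℝ≥0∞}, Measurable f →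
        Measurable fun s : ℝ => ∫⁻ v : Fin n → ℝ, f (Fin.cons s v) := fun hf =>
      (hf.comp mcons).lintegral_prod_right'
    have msec : ∀ {f : (Fin (n + 1) → ℝ) → ℝ≥0∞}, Measurable f →
        ∀ s : ℝ, Measurable fun v : Fin n → ℝ => f (Fin.cons s v) := fun hf s =>
      (hf.comp mcons).comp measurable_prodMk_left
    rw [lintegral_fin_succ hf, lintegral_fin_succ hg, lintegral_fin_succ hh]
    refine prekopaLeindler_real ha hb hab (mint hf) (mint hg) (mint hh) fun s t => ?_
    refine ih (msec hf s) (msec hg t) (msec hh _) fun v w => (H _ _).trans_eq ?_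
    congr 1
    ext i
    refine Fin.cases ?_ (fun i => ?_) i <;> simp

/-- The multiplicative form of the Brunn–Minkowski inequality. -/
theorem volume_rpow_mul_volume_rpow_le {a b : ℝ} (ha : 0 < a) (hb : 0 < b) (hab : a + b = 1)
    {N : ℕ} {A B C : Set (EuclideanSpace ℝ (Fin N))} (hA : MeasurableSet A)
    (hB : MeasurableSet B) (hC : MeasurableSet C) (H : ∀ x ∈ A, ∀ y ∈ B, a • x + b • y ∈ C) :
    volume A ^ a * volume B ^ b ≤ volume C := by
  have e := PiLp.volume_preserving_toLp (Fin N)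
  have hvol : ∀ {S : Set (EuclideanSpace ℝ (Fin N))}, MeasurableSet S →
      volume S = ∫⁻ x, (WithLp.toLp 2 ⁻¹' S).indicator 1 x := fun hS => by
    rw [lintegral_indicator_one (e.measurable hS), e.measure_preimage hS.nullMeasurableSet]
  rw [hvol hA, hvol hB, hvol hC]
  refine prekopaLeindler ha hb hab (measurable_one.indicator (e.measurable hA))
    (measurable_one.indicator (e.measurable hB)) (measurable_one.indicator (e.measurable hC))
    fun x y => ?_
  by_cases hx : WithLp.toLp 2 x ∈ A
  · by_cases hy : WithLp.toLp 2 y ∈ B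
    · have : WithLp.toLp 2 (a • x + b • y) ∈ C := H _ hx _ hy
      rw [indicator_of_mem (mem_preimage.2 hx), indicator_of_mem (mem_preimage.2 hy),
        indicator_of_mem (mem_preimage.2 this)]
      simp
    · simp [indicator_of_notMem (s := WithLp.toLp 2 ⁻¹' B) hy, hb]
  · simp [indicator_of_notMem (s := WithLp.toLp 2 ⁻¹' A) hx, ha]

section Reflection

variable {N : ℕ}

theorem inner_reflectH {l : ℝ} {ω : EuclideanSpace ℝ (Fin N)} (hω : ‖ω‖ = 1)
    (x : EuclideanSpace ℝ (Fin N)) : ⟪reflectH l ω x, ω⟫ = 2 * l - ⟪x, ω⟫ := by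
  rw [reflectH, inner_add_left, real_inner_smul_left, real_inner_self_eq_norm_sq, hω]
  ring

theorem reflectH_reflectH {l : ℝ} {ω : EuclideanSpace ℝ (Fin N)} (hω : ‖ω‖ = 1)
    (x : EuclideanSpace ℝ (Fin N)) : reflectH l ω (reflectH l ω x) = x := by
  rw [reflectH, inner_reflectH hω, reflectH]
  module

theorem dist_reflectH_sq {l : ℝ} {ω : EuclideanSpace ℝ (Fin N)} (hω : ‖ω‖ = 1)
    (x y : EuclideanSpace ℝ (Fin N)) :
    dist (reflectH l ω x) y ^ 2 = dist x y ^ 2 + 4 * (l - ⟪x, ω⟫) * (l - ⟪y, ω⟫) := by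
  have h : reflectH l ω x - y = (x - y) + (2 * (l - ⟪x, ω⟫)) • ω := by
    rw [reflectH]
    module
  rw [dist_eq_norm, dist_eq_norm, h, norm_add_sq_real, norm_smul, hω, real_inner_smul_right,
    inner_sub_left, mul_one, Real.norm_eq_abs, sq_abs]
  ring

theorem dist_reflectH_reflectH {l : ℝ} {ω : EuclideanSpace ℝ (Fin N)} (hω : ‖ω‖ = 1)
    (x y : EuclideanSpace ℝ (Fin N)) :
    dist (reflectH l ω x) (reflectH l ω y) = dist x y := by
  rw [← sq_eq_sq₀ dist_nonneg dist_nonneg, dist_reflectH_sq hω, dist_comm x, dist_reflectH_sq hω,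
    inner_reflectH hω, dist_comm y]
  ring

theorem dist_reflectH_left {l : ℝ} {ω : EuclideanSpace ℝ (Fin N)} (hω : ‖ω‖ = 1)
    (x y : EuclideanSpace ℝ (Fin N)) :
    dist (reflectH l ω x) y = dist x (reflectH l ω y) := by
  rw [← dist_reflectH_reflectH (l := l) hω, reflectH_reflectH hω]

theorem measurePreserving_reflectH {l : ℝ} {ω : EuclideanSpace ℝ (Fin N)} (hω : ‖ω‖ = 1) :
    MeasurePreserving (reflectH l ω) := by
  have h := ((measurePreserving_add_right volume ((2 * l) • ω)).comp
    ((ℝ ∙ ω)ᗮ.reflection.measurePreserving))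
  have heq : reflectH l ω = (fun x => x + (2 * l) • ω) ∘ (ℝ ∙ ω)ᗮ.reflection := by
    funext x
    rw [Function.comp_apply, Submodule.reflection_orthogonal_apply,
      Submodule.reflection_singleton_apply, hω, reflectH, real_inner_comm]
    simp
    module
  rw [heq]
  exact h

/-- Folding: if the upper cap of `K` reflects into `K`, then reflecting the center of a ball from
the upper half-space to the lower one does not decrease the measure of its intersection
with `K`. -/
theorem volume_inter_closedBall_le_reflectH {K : Set (EuclideanSpace ℝ (Fin N))}
    (hK : MeasurableSet K) {l : ℝ} {ω : EuclideanSpace ℝ (Fin N)} (hω : ‖ω‖ = 1)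
    (hl : reflectH l ω '' {x ∈ K | l ≤ ⟪x, ω⟫} ⊆ K) {x : EuclideanSpace ℝ (Fin N)}
    (hx : l ≤ ⟪x, ω⟫) (r : ℝ) :
    volume (K ∩ closedBall x r) ≤ volume (K ∩ closedBall (reflectH l ω x) r) := by
  set x' := reflectH l ω x
  have hB : ∀ z, MeasurableSet (closedBall z r : Set (EuclideanSpace ℝ (Fin N))) := fun z =>
    measurableSet_closedBall
  rw [← measure_inter_add_sdiff (K ∩ closedBall x r) (hB x'),
    ← measure_inter_add_sdiff (K ∩ closedBall x' r) (hB x),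
    inter_right_comm K (closedBall x' r)]
  refine add_le_add_right ?_ _
  rw [← (measurePreserving_reflectH (l := l) hω).measure_preimage
    ((hK.inter (hB x')).diff (hB x)).nullMeasurableSet]
  refine measure_mono ?_
  rintro y ⟨⟨hyK, hyx⟩, hyx'⟩
  simp only [mem_closedBall, not_le] at hyx hyx'
  have h1 : dist (reflectH l ω y) x = dist y x' := dist_reflectH_left hω _ _
  have h2 : dist (reflectH l ω y) x' = dist y x := dist_reflectH_reflectH hω _ _
  have hy : l ≤ ⟪y, ω⟫ := by
    by_contra! hy
    have h3 := dist_reflectH_sq (l := l) hω x y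
    have h4 : dist x' y ≤ dist x y := by
      refine (sq_le_sq₀ dist_nonneg dist_nonneg).1 ?_
      nlinarith
    rw [dist_comm x', dist_comm x] at h4
    linarith
  refine ⟨⟨hl ⟨y, ⟨hyK, hy⟩, rfl⟩, ?_⟩, ?_⟩
  · simpa [h2] using hyx
  · simpa [h1] using hyx'

theorem foldingSet_nonempty {K : Set (EuclideanSpace ℝ (Fin N))} (hK : IsCompact K)
    (ω : EuclideanSpace ℝ (Fin N)) :
    {l : ℝ | reflectH l ω '' {x ∈ K | l ≤ ⟪x, ω⟫} ⊆ K}.Nonempty := by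
  obtain ⟨M, hM⟩ := (hK.image (f := fun x => ⟪x, ω⟫) (by fun_prop)).bddAbove
  refine ⟨M + 1, ?_⟩
  rintro _ ⟨x, ⟨hx, hlx⟩, rfl⟩
  have := hM ⟨x, hx, rfl⟩
  simp only at this
  linarith

/-- A nonempty compact convex set contains a point (its circumcenter) that lies below every
hyperplane along which the set folds into itself. -/
theorem exists_mem_forall_inner_le {M : Set (EuclideanSpace ℝ (Fin N))} (hM : IsCompact M)
    (hconv : Convex ℝ M) (hne : M.Nonempty) :
    ∃ x ∈ M, ∀ ω : EuclideanSpace ℝ (Fin N), ‖ω‖ = 1 → ∀ l : ℝ,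
      reflectH l ω '' {x ∈ M | l ≤ ⟪x, ω⟫} ⊆ M → ⟪x, ω⟫ ≤ l := by
  obtain ⟨x, hxM, hx⟩ := hM.exists_isMinOn hne
    (hM.continuous_sSup (f := fun x y : EuclideanSpace ℝ (Fin N) => dist x y)
      continuous_dist).continuousOn
  refine ⟨x, hxM, fun ω hω l hl => ?_⟩
  by_contra! hlx
  set m := (1 / 2 : ℝ) • x + (1 / 2 : ℝ) • reflectH l ω x
  have hx' : reflectH l ω x ∈ M := hl ⟨x, ⟨hxM, hlx.le⟩, rfl⟩
  have hmM : m ∈ M := hconv hxM hx' (by norm_num) (by norm_num) (by norm_num)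
  obtain ⟨y, hyM, hy⟩ := hM.exists_sSup_image_eq hne (f := fun y => dist m y)
    (by fun_prop)
  have hxm : sSup ((fun y => dist x y) '' M) ≤ dist m y := hy ▸ hx hmM
  have hbd : ∀ z ∈ M, dist x z ≤ dist m y := fun z hz =>
    (le_csSup (hM.image (by fun_prop)).bddAbove (mem_image_of_mem (fun y => dist x y) hz)).trans
      hxm
  have hm : m = x + (l - ⟪x, ω⟫) • ω := by
    simp only [m, reflectH]
    module
  have hd : dist m y ^ 2 =
      dist x y ^ 2 + 2 * (l - ⟪x, ω⟫) * (⟪x, ω⟫ - ⟪y, ω⟫) + (l - ⟪x, ω⟫) ^ 2 := by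
    have : m - y = (x - y) + (l - ⟪x, ω⟫) • ω := by
      rw [hm]
      module
    rw [dist_eq_norm, dist_eq_norm, this, norm_add_sq_real, norm_smul, hω, real_inner_smul_right,
      inner_sub_left, mul_one, Real.norm_eq_abs, sq_abs]
    ring
  have hxy : dist x y ^ 2 ≤ dist m y ^ 2 := by
    have := hbd y hyM
    gcongr
  rcases le_total l ⟪y, ω⟫ with hly | hly
  · have h1 := hbd _ (hl ⟨y, ⟨hyM, hly⟩, rfl⟩)
    rw [← dist_reflectH_left hω] at h1
    have h2 : dist (reflectH l ω x) y ^ 2 ≤ dist m y ^ 2 := by gcongr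
    rw [dist_reflectH_sq hω] at h2
    nlinarith
  · nlinarith

end Reflection

theorem upperSemicontinuous_volume_inter_closedBall {N : ℕ} {K : Set (EuclideanSpace ℝ (Fin N))}
    (hK : IsCompact K) (r : ℝ) :
    UpperSemicontinuous fun x => volume (K ∩ closedBall x r) := by
  intro x c hc
  have ht := tendsto_measure_biInter_gt (μ := volume) (s := fun ρ => K ∩ closedBall x ρ) (a := r)
    (fun ρ _ => (hK.measurableSet.inter measurableSet_closedBall).nullMeasurableSet)
    (fun i j _ hij => by gcongr)
    ⟨r + 1, by simp, (measure_mono inter_subset_left).trans_lt hK.measure_lt_top |>.ne⟩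
  have hI : ⋂ ρ > r, K ∩ closedBall x ρ = K ∩ closedBall x r := by
    ext y
    simp only [mem_iInter, mem_inter_iff, mem_closedBall]
    refine ⟨fun h => ⟨(h (r + 1) (by simp)).1, le_of_forall_gt_imp_ge_of_dense fun ρ hρ =>
      (h ρ hρ).2⟩, fun h ρ hρ => ⟨h.1, h.2.trans (le_of_lt hρ)⟩⟩
  rw [hI] at ht
  obtain ⟨ρ, hρc, hρ⟩ := ((ht.eventually_lt_const hc).and self_mem_nhdsWithin).exists
  filter_upwards [ball_mem_nhds x (sub_pos.2 hρ)] with z hz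
  refine (measure_mono ?_).trans_lt hρc
  refine inter_subset_inter_right _ (closedBall_subset_closedBall' ?_)
  have := mem_ball.1 hz
  linarith

/-- Replacing a point by its projection onto `K` does not decrease `|K ∩ B(x, r)|`. -/
theorem exists_mem_closedBall_inter_subset {N : ℕ} {K : Set (EuclideanSpace ℝ (Fin N))}
    (hK : IsClosed K) (hconv : Convex ℝ K) (hne : K.Nonempty) (z : EuclideanSpace ℝ (Fin N))
    (r : ℝ) : ∃ p ∈ K, K ∩ closedBall z r ⊆ K ∩ closedBall p r := by
  obtain ⟨p, hp, hmin⟩ := exists_norm_eq_iInf_of_complete_convex hne hK.isComplete hconv z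
  rw [norm_eq_iInf_iff_real_inner_le_zero hconv hp] at hmin
  refine ⟨p, hp, fun y ⟨hy, hyz⟩ => ⟨hy, ?_⟩⟩
  rw [mem_closedBall] at *
  refine le_trans ?_ hyz
  have h1 := hmin y hy
  have h2 : ‖y - z‖ ^ 2 = ‖y - p‖ ^ 2 - 2 * ⟪z - p, y - p⟫ + ‖z - p‖ ^ 2 := by
    rw [real_inner_comm, ← norm_sub_sq_real]
    congr 2
    abel
  rw [dist_eq_norm, dist_eq_norm]
  refine (sq_le_sq₀ (norm_nonneg _) (norm_nonneg _)).1 ?_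
  nlinarith [sq_nonneg ‖z - p‖]

theorem volume_inter_closedBall_rpow_mul_rpow_le {N : ℕ} {K : Set (EuclideanSpace ℝ (Fin N))}
    (hK : MeasurableSet K) (hconv : Convex ℝ K) (r : ℝ) (x y : EuclideanSpace ℝ (Fin N))
    {a b : ℝ} (ha : 0 < a) (hb : 0 < b) (hab : a + b = 1) :
    volume (K ∩ closedBall x r) ^ a * volume (K ∩ closedBall y r) ^ b ≤
      volume (K ∩ closedBall (a • x + b • y) r) := by
  refine volume_rpow_mul_volume_rpow_le ha hb hab (hK.inter measurableSet_closedBall)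
    (hK.inter measurableSet_closedBall) (hK.inter measurableSet_closedBall) ?_
  rintro u ⟨huK, hu⟩ v ⟨hvK, hv⟩
  refine ⟨hconv huK hvK ha.le hb.le hab, ?_⟩
  rw [mem_closedBall, dist_eq_norm] at *
  calc ‖a • u + b • v - (a • x + b • y)‖ = ‖a • (u - x) + b • (v - y)‖ := by
        congr 1
        module
    _ ≤ a * ‖u - x‖ + b * ‖v - y‖ := by
        refine (norm_add_le _ _).trans_eq ?_
        rw [norm_smul, norm_smul, Real.norm_of_nonneg ha.le, Real.norm_of_nonneg hb.le]
    _ ≤ a * r + b * r := by gcongr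
    _ = r := by rw [← add_mul, hab, one_mul]

/-- For fixed `r > 0`, the function `γ(x) = |K ∩ B(x,r)|` is log-concave on `ℝ^N`, and
the set of its maximum points meets the heart of `K`. -/
theorem statement17 {N : ℕ} (K : Set (EuclideanSpace ℝ (Fin N)))
    (hKcpt : IsCompact K) (hKconv : Convex ℝ K) (hKint : (interior K).Nonempty)
    (r : ℝ) (hr : 0 < r) :
    (∀ x y : EuclideanSpace ℝ (Fin N), ∀ t ∈ Ioo (0 : ℝ) 1,
      (volume (K ∩ closedBall x r)).toReal ^ (1 - t) *
          (volume (K ∩ closedBall y r)).toReal ^ t ≤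
        (volume (K ∩ closedBall ((1 - t) • x + t • y) r)).toReal) ∧
    ∃ x ∈ heart K, ∀ z : EuclideanSpace ℝ (Fin N),
      volume (K ∩ closedBall z r) ≤ volume (K ∩ closedBall x r) := by
  have hKm : MeasurableSet K := hKcpt.measurableSet
  constructor
  · intro x y t ht
    rw [ENNReal.toReal_rpow, ENNReal.toReal_rpow, ← ENNReal.toReal_mul]
    refine ENNReal.toReal_mono ?_ (volume_inter_closedBall_rpow_mul_rpow_le hKm hKconv r x y
      (sub_pos.2 ht.2) ht.1 (by ring))
    exact ((measure_mono inter_subset_left).trans_lt hKcpt.measure_lt_top).ne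
  have hne : K.Nonempty := hKint.mono interior_subset
  have husc := upperSemicontinuous_volume_inter_closedBall hKcpt r
  obtain ⟨x₀, hx₀, hmax⟩ := husc.upperSemicontinuousOn K |>.exists_isMaxOn hne hKcpt
  have hglob : ∀ z, volume (K ∩ closedBall z r) ≤ volume (K ∩ closedBall x₀ r) := fun z => by
    obtain ⟨p, hp, hsub⟩ := exists_mem_closedBall_inter_subset hKcpt.isClosed hKconv hne z r
    exact (measure_mono hsub).trans (hmax hp)
  set m := volume (K ∩ closedBall x₀ r)
  set M := K ∩ {x | m ≤ volume (K ∩ closedBall x r)}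
  have hMcpt : IsCompact M := hKcpt.inter_right (husc.isClosed_preimage m)
  have hMconv : Convex ℝ M := by
    refine convex_iff_forall_pos.2 fun x hx y hy a b ha hb hab =>
      ⟨hKconv hx.1 hy.1 ha.le hb.le hab, ?_⟩
    refine le_trans ?_ (volume_inter_closedBall_rpow_mul_rpow_le hKm hKconv r x y ha hb hab)
    exact (le_min hx.2 hy.2).trans (ENNReal.min_le_rpow_mul_rpow ha hb hab _ _)
  obtain ⟨x, hxM, hx⟩ := exists_mem_forall_inner_le hMcpt hMconv ⟨x₀, hx₀, le_refl m⟩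
  refine ⟨x, ⟨hxM.1, fun ω hω => le_csInf (foldingSet_nonempty hKcpt ω) fun l hl =>
    hx ω hω l ?_⟩, fun z => (hglob z).trans hxM.2⟩
  rintro _ ⟨y, ⟨hyM, hly⟩, rfl⟩
  exact ⟨hl ⟨y, ⟨hyM.1, hly⟩, rfl⟩,
    le_trans hyM.2 (volume_inter_closedBall_le_reflectH hKm hω hl hly r)⟩
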